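/- Let 1 < c < 3/2 and ε > 0, and set γ = 1/c. There is a constant C = C(c, ε) such that for all sufficiently large real N the following holds: the number Z_c(N) of integers n with N < n ≤ N(1 + (log N)^{-2}) that cannot be represented in the form ⌊m^c⌋ + ⌊p^c⌋ = n with m a positive integer and p prime satisfies Z_c(N) ≤ C · N^{3 − 3/c + 5ε/6}. -/

import Mathlib

open Finset

/-- The additive character `x ↦ exp (2πix)` of the real line. -/
noncomputable def expTwoPiI (x : ℝ) : ℂ := Complex.exp ((2 * Real.pi * x : ℝ) * Complex.I)

lemma expTwoPiI_add (x y : ℝ) : expTwoPiI (x + y) = expTwoPiI x * expTwoPiI y := by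
  rw [expTwoPiI, expTwoPiI, expTwoPiI, ← Complex.exp_add]
  congr 1
  push_cast
  ring

lemma expTwoPiI_zero : expTwoPiI 0 = 1 := by simp [expTwoPiI]

lemma norm_expTwoPiI (x : ℝ) : ‖expTwoPiI x‖ = 1 := Complex.norm_exp_ofReal_mul_I _

lemma expTwoPiI_intCast (n : ℤ) : expTwoPiI n = 1 := by
  rw [expTwoPiI, Complex.exp_eq_one_iff]
  exact ⟨n, by push_cast; ring⟩

lemma conj_expTwoPiI (x : ℝ) : starRingEnd ℂ (expTwoPiI x) = expTwoPiI (-x) := by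
  rw [expTwoPiI, expTwoPiI, ← Complex.exp_conj, map_mul, Complex.conj_ofReal, Complex.conj_I]
  congr 1
  push_cast
  ring

lemma re_expTwoPiI (x : ℝ) : (expTwoPiI x).re = Real.cos (2 * Real.pi * x) :=
  Complex.exp_ofReal_mul_I_re _

lemma im_expTwoPiI (x : ℝ) : (expTwoPiI x).im = Real.sin (2 * Real.pi * x) :=
  Complex.exp_ofReal_mul_I_im _

lemma continuous_expTwoPiI : Continuous expTwoPiI := by
  unfold expTwoPiI
  fun_prop

/-- The value of `1 / (1 - e(x))` in terms of the cotangent. -/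
noncomputable def halfCot (x : ℝ) : ℂ :=
  1 / 2 + (Real.cos (Real.pi * x) / Real.sin (Real.pi * x) / 2 : ℝ) * Complex.I

lemma one_sub_expTwoPiI_mul_halfCot {x : ℝ} (hx : Real.sin (Real.pi * x) ≠ 0) :
    (1 - expTwoPiI x) * halfCot x = 1 := by
  have h2 : 2 * Real.pi * x = 2 * (Real.pi * x) := by ring
  have h := Real.sin_sq_add_cos_sq (Real.pi * x)
  have hre : (halfCot x).re = 1 / 2 := by
    rw [halfCot, Complex.add_re, Complex.re_ofReal_mul]
    simp
  have him : (halfCot x).im = Real.cos (Real.pi * x) / Real.sin (Real.pi * x) / 2 := by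
    rw [halfCot, Complex.add_im, Complex.im_ofReal_mul]
    simp
  apply Complex.ext
  · rw [Complex.mul_re, hre, him, Complex.sub_re, Complex.sub_im, re_expTwoPiI, im_expTwoPiI, h2,
      Real.cos_two_mul, Real.sin_two_mul, Complex.one_re, Complex.one_im]
    field_simp
    linarith
  · rw [Complex.mul_im, hre, him, Complex.sub_re, Complex.sub_im, re_expTwoPiI, im_expTwoPiI, h2,
      Real.cos_two_mul, Real.sin_two_mul, Complex.one_re, Complex.one_im]
    field_simp
    linear_combination (-2) * Real.cos (Real.pi * x) * h

lemma two_mul_le_sin_pi_mul {θ x : ℝ} (hθ : 0 ≤ θ) (h1 : θ ≤ x) (h2 : x ≤ 1 - θ) :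
    2 * θ ≤ Real.sin (Real.pi * x) := by
  have hpi := Real.pi_pos
  rcases le_total x (1 / 2) with h | h
  · have := Real.mul_le_sin (x := Real.pi * x)
      (mul_nonneg hpi.le (hθ.trans h1)) (by nlinarith)
    have e : 2 / Real.pi * (Real.pi * x) = 2 * x := by field_simp
    linarith
  · have := Real.mul_le_sin (x := Real.pi * (1 - x)) (by apply mul_nonneg <;> linarith)
      (by nlinarith)
    have e : 2 / Real.pi * (Real.pi * (1 - x)) = 2 * (1 - x) := by field_simp
    rw [e, show Real.pi * (1 - x) = Real.pi - Real.pi * x by ring, Real.sin_pi_sub] at this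
    linarith

lemma cot_pi_mul_le_of_le {x y : ℝ} (hx : 0 < x) (hxy : x ≤ y) (hy : y < 1) :
    Real.cos (Real.pi * y) / Real.sin (Real.pi * y) ≤
      Real.cos (Real.pi * x) / Real.sin (Real.pi * x) := by
  have hpi := Real.pi_pos
  have sx : 0 < Real.sin (Real.pi * x) :=
    Real.sin_pos_of_pos_of_lt_pi (by positivity) (by nlinarith)
  have sy : 0 < Real.sin (Real.pi * y) :=
    Real.sin_pos_of_pos_of_lt_pi (by nlinarith) (by nlinarith)
  rw [div_le_div_iff₀ sy sx]
  have := Real.sin_nonneg_of_nonneg_of_le_pi (x := Real.pi * y - Real.pi * x)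
    (by nlinarith) (by nlinarith)
  rw [Real.sin_sub] at this
  linarith

lemma abs_cot_pi_mul_le {θ x : ℝ} (hθ : 0 < θ) (h1 : θ ≤ x) (h2 : x ≤ 1 - θ) :
    |Real.cos (Real.pi * x) / Real.sin (Real.pi * x)| ≤ 1 / (2 * θ) := by
  have hs := two_mul_le_sin_pi_mul hθ.le h1 h2
  rw [abs_div, abs_of_pos (show 0 < Real.sin (Real.pi * x) by linarith)]
  exact div_le_div₀ zero_le_one (Real.abs_cos_le_one _) (by positivity) hs

lemma norm_halfCot_le {θ x : ℝ} (hθ : 0 < θ) (h1 : θ ≤ x) (h2 : x ≤ 1 - θ) :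
    ‖halfCot x‖ ≤ 1 / (2 * θ) := by
  have h := abs_cot_pi_mul_le hθ h1 h2
  have hθ2 : 1 ≤ 1 / (2 * θ) := by
    rw [le_div_iff₀ (by positivity)]; linarith
  calc ‖halfCot x‖ ≤ ‖(1 / 2 : ℂ)‖ +
        ‖((Real.cos (Real.pi * x) / Real.sin (Real.pi * x) / 2 : ℝ) : ℂ) * Complex.I‖ :=
        norm_add_le _ _
    _ = 1 / 2 + |Real.cos (Real.pi * x) / Real.sin (Real.pi * x)| / 2 := by
        rw [norm_mul, Complex.norm_I, Complex.norm_real, Real.norm_eq_abs, abs_div]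
        norm_num
    _ ≤ _ := by linarith

lemma norm_halfCot_sub {x y : ℝ} (hx : 0 < x) (hxy : x ≤ y) (hy : y < 1) :
    ‖halfCot y - halfCot x‖ = (Real.cos (Real.pi * x) / Real.sin (Real.pi * x) -
      Real.cos (Real.pi * y) / Real.sin (Real.pi * y)) / 2 := by
  have h := cot_pi_mul_le_of_le hx hxy hy
  have : halfCot y - halfCot x = ((Real.cos (Real.pi * y) / Real.sin (Real.pi * y) -
      Real.cos (Real.pi * x) / Real.sin (Real.pi * x)) / 2 : ℝ) * Complex.I := by
    simp only [halfCot]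
    push_cast
    ring
  rw [this, norm_mul, Complex.norm_I, Complex.norm_real, Real.norm_eq_abs, abs_of_nonpos] <;>
    linarith

/-- The Kusmin–Landau inequality, for a phase whose increments lie in `[θ, 1 - θ]`. -/
lemma norm_sum_expTwoPiI_le_of_increments_mem {f : ℕ → ℝ} {a b : ℕ} {θ : ℝ} (hθ : 0 < θ)
    (hmono : ∀ n, a ≤ n → n + 1 < b → f (n + 1) - f n ≤ f (n + 2) - f (n + 1))
    (hmem : ∀ n, a ≤ n → n < b → θ ≤ f (n + 1) - f n ∧ f (n + 1) - f n ≤ 1 - θ) :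
    ‖∑ n ∈ Ico a b, expTwoPiI (f n)‖ ≤ 2 / θ := by
  rcases le_or_gt b a with hab | hab
  · rw [Ico_eq_empty_of_le hab]
    simp only [sum_empty, norm_zero]
    positivity
  set g : ℕ → ℝ := fun n => f (n + 1) - f n with hg
  have hstep : ∀ n, a ≤ n → n < b →
      expTwoPiI (f n) + expTwoPiI (f (n + 1)) * halfCot (g n) = expTwoPiI (f n) * halfCot (g n) := by
    intro n h1 h2
    obtain ⟨h3, h4⟩ := hmem n h1 h2
    have h5 := two_mul_le_sin_pi_mul hθ.le h3 h4
    have h6 := one_sub_expTwoPiI_mul_halfCot (x := g n) (lt_of_lt_of_le (by positivity) h5).ne'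
    have h7 : expTwoPiI (f (n + 1)) = expTwoPiI (f n) * expTwoPiI (g n) := by
      rw [← expTwoPiI_add]; simp [hg]
    rw [h7]
    linear_combination (-1) * expTwoPiI (f n) * h6
  have key : ∀ m, a ≤ m → m < b →
      ‖∑ n ∈ Ico a (m + 1), expTwoPiI (f n) + expTwoPiI (f (m + 1)) * halfCot (g m)‖ ≤
        ‖halfCot (g a)‖ + (Real.cos (Real.pi * g a) / Real.sin (Real.pi * g a) -
      Real.cos (Real.pi * g m) / Real.sin (Real.pi * g m)) / 2 := by
    intro m hm
    induction m, hm using Nat.le_induction with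
    | base =>
      intro h
      rw [Nat.Ico_succ_singleton, sum_singleton, hstep a le_rfl h, norm_mul, norm_expTwoPiI]
      simp
    | succ m hm ih =>
      intro h
      have ih := ih (by omega)
      have h1 := hstep (m + 1) (by omega) h
      rw [sum_Ico_succ_top (by omega), add_assoc, h1]
      have h2 : ∑ n ∈ Ico a (m + 1), expTwoPiI (f n) +
          expTwoPiI (f (m + 1)) * halfCot (g (m + 1)) =
          (∑ n ∈ Ico a (m + 1), expTwoPiI (f n) + expTwoPiI (f (m + 1)) * halfCot (g m)) +
          expTwoPiI (f (m + 1)) * (halfCot (g (m + 1)) - halfCot (g m)) := by ring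
      rw [h2]
      refine (norm_add_le _ _).trans ?_
      rw [norm_mul, norm_expTwoPiI, one_mul, norm_halfCot_sub]
      · linarith
      · linarith [(hmem m hm (by omega)).1]
      · exact hmono m hm h
      · linarith [(hmem (m + 1) (by omega) h).2]
  obtain ⟨m, rfl⟩ : ∃ m, b = m + 1 := ⟨b - 1, by omega⟩
  have h1 := key m (by omega) (by omega)
  obtain ⟨ha1, ha2⟩ := hmem a le_rfl hab
  obtain ⟨hm1, hm2⟩ := hmem m (by omega) (by omega)
  have ca := abs_le.1 (abs_cot_pi_mul_le hθ ha1 ha2)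
  have cm := abs_le.1 (abs_cot_pi_mul_le hθ hm1 hm2)
  have wa := norm_halfCot_le hθ ha1 ha2
  have wm := norm_halfCot_le hθ hm1 hm2
  have h2 : ∑ n ∈ Ico a (m + 1), expTwoPiI (f n) =
      (∑ n ∈ Ico a (m + 1), expTwoPiI (f n) + expTwoPiI (f (m + 1)) * halfCot (g m)) -
        expTwoPiI (f (m + 1)) * halfCot (g m) := by ring
  rw [h2]
  refine (norm_sub_le _ _).trans ?_
  rw [norm_mul, norm_expTwoPiI, one_mul]
  have h3 : 2 / θ = 4 * (1 / (2 * θ)) := by field_simp; norm_num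
  simp only [hg] at h1 ⊢
  have := one_div_pos.2 (mul_pos two_pos hθ)
  linarith [ca.1, ca.2, cm.1, cm.2]

/-- The Kusmin–Landau inequality, for a phase whose increments keep distance `θ` from `ℤ`. -/
lemma norm_sum_expTwoPiI_le_of_increments_mem_add_int {f : ℕ → ℝ} {a b : ℕ} {θ : ℝ} (j : ℤ)
    (hθ : 0 < θ)
    (hmono : ∀ n, a ≤ n → n + 1 < b → f (n + 1) - f n ≤ f (n + 2) - f (n + 1))
    (hmem : ∀ n, a ≤ n → n < b → j + θ ≤ f (n + 1) - f n ∧ f (n + 1) - f n ≤ j + 1 - θ) :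
    ‖∑ n ∈ Ico a b, expTwoPiI (f n)‖ ≤ 2 / θ := by
  have h : ∀ n : ℕ, expTwoPiI (f n) = expTwoPiI (f n - j * n) := by
    intro n
    have h1 : f n = f n - j * n + ((j * n : ℤ) : ℝ) := by push_cast; ring
    conv_lhs => rw [h1, expTwoPiI_add, expTwoPiI_intCast, mul_one]
  simp_rw [h]
  refine norm_sum_expTwoPiI_le_of_increments_mem hθ ?_ ?_
  · intro n h1 h2
    have := hmono n h1 h2
    push_cast
    linarith
  · intro n h1 h2
    have := hmem n h1 h2
    push_cast
    constructor <;> linarith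

lemma exists_eq_Ico_of_ordConnected {S : Finset ℕ}
    (hS : ∀ x ∈ S, ∀ y ∈ S, ∀ z, x ≤ z → z ≤ y → z ∈ S) : ∃ a b, S = Ico a b := by
  rcases S.eq_empty_or_nonempty with rfl | hne
  · exact ⟨0, 0, by simp⟩
  · refine ⟨S.min' hne, S.max' hne + 1, ?_⟩
    ext z
    rw [mem_Ico, Nat.lt_succ_iff]
    exact ⟨fun hz => ⟨S.min'_le z hz, S.le_max' z hz⟩,
      fun hz => hS _ (S.min'_mem hne) _ (S.max'_mem hne) z hz.1 hz.2⟩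

/-- A finite set of integers whose images under an expanding map lie in an interval of
length `d` is small. -/
lemma card_le_of_expanding {S : Finset ℕ} {g : ℕ → ℝ} {lam u d : ℝ} (hlam : 0 < lam)
    (hd : 0 ≤ d)
    (hg : ∀ x ∈ S, ∀ y ∈ S, x ≤ y → lam * ((y : ℝ) - x) ≤ g y - g x)
    (hmem : ∀ x ∈ S, u ≤ g x ∧ g x ≤ u + d) : (S.card : ℝ) ≤ d / lam + 1 := by
  rcases S.eq_empty_or_nonempty with rfl | hne
  · simp only [card_empty, Nat.cast_zero]
    positivity
  · have hsub : S ⊆ Icc (S.min' hne) (S.max' hne) := fun z hz =>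
      mem_Icc.2 ⟨S.min'_le z hz, S.le_max' z hz⟩
    have hle : S.min' hne ≤ S.max' hne := S.min'_le _ (S.max'_mem hne)
    have h1 := card_le_card hsub
    rw [Nat.card_Icc] at h1
    have h2 : (S.card : ℝ) ≤ (S.max' hne : ℝ) - S.min' hne + 1 := by
      have : S.card + S.min' hne ≤ S.max' hne + 1 := by omega
      have : (S.card : ℝ) + S.min' hne ≤ S.max' hne + 1 := by exact_mod_cast this
      linarith
    have h3 := hg _ (S.min'_mem hne) _ (S.max'_mem hne) hle
    have h4 := hmem _ (S.min'_mem hne)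
    have h5 := hmem _ (S.max'_mem hne)
    have h6 : (S.max' hne : ℝ) - S.min' hne ≤ d / lam := by
      rw [le_div_iff₀ hlam]; linarith
    linarith

lemma mul_sub_le_sub_of_increments {g : ℕ → ℝ} {a b : ℕ} {l u : ℝ}
    (h : ∀ n, a ≤ n → n < b → l ≤ g (n + 1) - g n ∧ g (n + 1) - g n ≤ u) {x y : ℕ}
    (hx : a ≤ x) (hxy : x ≤ y) (hy : y ≤ b) :
    l * ((y : ℝ) - x) ≤ g y - g x ∧ g y - g x ≤ u * ((y : ℝ) - x) := by
  induction y, hxy using Nat.le_induction with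
  | base => simp
  | succ y hxy ih =>
    obtain ⟨h1, h2⟩ := h y (by omega) (by omega)
    obtain ⟨h3, h4⟩ := ih (by omega)
    push_cast
    constructor <;> linarith

/-- The contribution of the increments in `[j, j + 1)` to an exponential sum. -/
lemma norm_sum_floor_fiber_le {f : ℕ → ℝ} {a b : ℕ} {lam Δ : ℝ} (hlam : 0 < lam) (hΔ : 0 < Δ)
    (h : ∀ x y, a ≤ x → x ≤ y → y < b →
      lam * ((y : ℝ) - x) ≤ (f (y + 1) - f y) - (f (x + 1) - f x)) (j : ℤ) :
    ‖∑ n ∈ Ico a b with ⌊f (n + 1) - f n⌋ = j, expTwoPiI (f n)‖ ≤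
      2 * (Δ / lam + 1) + 2 / Δ := by
  set g : ℕ → ℝ := fun n => f (n + 1) - f n with hg
  have hmono : ∀ x y, a ≤ x → x ≤ y → y < b → g x ≤ g y := by
    intro x y h1 h2 h3
    have h4 := h x y h1 h2 h3
    have h5 : (x : ℝ) ≤ y := by exact_mod_cast h2
    have : 0 ≤ lam * ((y : ℝ) - x) := mul_nonneg hlam.le (by linarith)
    simp only [hg]
    linarith
  set S := (Ico a b).filter (fun n => ⌊g n⌋ = j) with hS
  have hSmem : ∀ n, n ∈ S ↔ (a ≤ n ∧ n < b) ∧ (j : ℝ) ≤ g n ∧ g n < j + 1 := by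
    intro n
    rw [hS, mem_filter, mem_Ico, Int.floor_eq_iff]
  set S₁ := S.filter (fun n => g n < j + Δ)
  set S₂ := S.filter (fun n => ¬ g n < j + Δ)
  set S₃ := S₂.filter (fun n => j + 1 - Δ < g n)
  set S₄ := S₂.filter (fun n => ¬ j + 1 - Δ < g n)
  have e1 : ∑ n ∈ S, expTwoPiI (f n) = ∑ n ∈ S₁, expTwoPiI (f n) + (∑ n ∈ S₃, expTwoPiI (f n) +
      ∑ n ∈ S₄, expTwoPiI (f n)) := by
    rw [sum_filter_add_sum_filter_not S₂, sum_filter_add_sum_filter_not S]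
  have triv : ∀ T : Finset ℕ, ‖∑ n ∈ T, expTwoPiI (f n)‖ ≤ T.card := by
    intro T
    refine (norm_sum_le _ _).trans ?_
    simp [norm_expTwoPiI]
  have hexp : ∀ T ⊆ S, ∀ x ∈ T, ∀ y ∈ T, x ≤ y → lam * ((y : ℝ) - x) ≤ g y - g x := by
    intro T hT x hx y hy hxy
    exact h x y ((hSmem x).1 (hT hx)).1.1 hxy ((hSmem y).1 (hT hy)).1.2
  have b1 : ‖∑ n ∈ S₁, expTwoPiI (f n)‖ ≤ Δ / lam + 1 := by
    refine (triv _).trans (card_le_of_expanding (u := j) hlam hΔ.le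
      (hexp _ (filter_subset _ _)) ?_)
    intro x hx
    obtain ⟨h1, h2⟩ := mem_filter.1 hx
    exact ⟨((hSmem x).1 h1).2.1, h2.le⟩
  have b3 : ‖∑ n ∈ S₃, expTwoPiI (f n)‖ ≤ Δ / lam + 1 := by
    refine (triv _).trans (card_le_of_expanding (u := j + 1 - Δ) hlam hΔ.le
      (hexp _ ((filter_subset _ _).trans (filter_subset _ _))) ?_)
    intro x hx
    obtain ⟨h1, h2⟩ := mem_filter.1 hx
    have h3 := ((hSmem x).1 (mem_filter.1 h1).1).2.2
    exact ⟨h2.le, by linarith⟩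
  have m4 : ∀ n, n ∈ S₄ ↔ ((a ≤ n ∧ n < b) ∧ (j : ℝ) ≤ g n ∧ g n < j + 1) ∧
      (j + Δ ≤ g n ∧ g n ≤ j + 1 - Δ) := by
    intro n
    simp only [S₄, S₂, mem_filter, hSmem, not_lt]
    tauto
  have b4 : ‖∑ n ∈ S₄, expTwoPiI (f n)‖ ≤ 2 / Δ := by
    obtain ⟨a', b', hab⟩ : ∃ a' b', S₄ = Ico a' b' := by
      apply exists_eq_Ico_of_ordConnected
      intro x hx y hy z hxz hzy
      rw [m4] at hx hy ⊢
      have h1 := hmono x z hx.1.1.1 hxz (by omega)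
      have h2 := hmono z y (by omega) hzy hy.1.1.2
      refine ⟨⟨⟨by omega, by omega⟩, by linarith, by linarith⟩, by linarith, by linarith⟩
    have m5 : ∀ n, a' ≤ n → n < b' → n ∈ S₄ := fun n h1 h2 => by
      rw [hab, mem_Ico]; exact ⟨h1, h2⟩
    rw [hab]
    apply norm_sum_expTwoPiI_le_of_increments_mem_add_int j hΔ
    · intro n h1 h2
      have h3 := (m4 n).1 (m5 n h1 (by omega))
      have h4 := (m4 _).1 (m5 (n + 1) (by omega) h2)
      exact hmono n (n + 1) h3.1.1.1 (by omega) h4.1.1.2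
    · intro n h1 h2
      exact ((m4 n).1 (m5 n h1 h2)).2
  rw [e1]
  refine (norm_add_le _ _).trans ?_
  have := norm_add_le (∑ n ∈ S₃, expTwoPiI (f n)) (∑ n ∈ S₄, expTwoPiI (f n))
  linarith

/-- Van der Corput's second derivative test, in terms of second differences. -/
theorem norm_sum_expTwoPiI_le_of_second_differences {f : ℕ → ℝ} {a b : ℕ} {lam C : ℝ}
    (hlam : 0 < lam) (hC : 1 ≤ C) (hab : a ≤ b)
    (h : ∀ n, a ≤ n → n < b → lam ≤ (f (n + 2) - f (n + 1)) - (f (n + 1) - f n) ∧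
      (f (n + 2) - f (n + 1)) - (f (n + 1) - f n) ≤ C * lam) :
    ‖∑ n ∈ Ico a b, expTwoPiI (f n)‖ ≤
      6 * C * ((b : ℝ) - a) * √lam + 12 / √lam := by
  have hs : 0 < √lam := Real.sqrt_pos.2 hlam
  have hss : √lam * √lam = lam := Real.mul_self_sqrt hlam.le
  have hL : (0 : ℝ) ≤ (b : ℝ) - a := by
    have : (a : ℝ) ≤ b := by exact_mod_cast hab
    linarith
  rcases le_or_gt lam 1 with h1 | h1
  · rcases hab.eq_or_lt with rfl | hlt
    · simp only [Ico_self, sum_empty, norm_zero]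
      positivity
    set g : ℕ → ℝ := fun n => f (n + 1) - f n with hg
    have hgap : ∀ x y, a ≤ x → x ≤ y → y ≤ b →
        lam * ((y : ℝ) - x) ≤ g y - g x ∧ g y - g x ≤ C * lam * ((y : ℝ) - x) :=
      fun x y hx hxy hy => mul_sub_le_sub_of_increments h hx hxy hy
    have hmono : ∀ x y, a ≤ x → x ≤ y → y ≤ b → g x ≤ g y := by
      intro x y hx hxy hy
      have h4 := (hgap x y hx hxy hy).1
      have h5 : (x : ℝ) ≤ y := by exact_mod_cast hxy
      have : 0 ≤ lam * ((y : ℝ) - x) := mul_nonneg hlam.le (by linarith)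
      linarith
    set J := Icc ⌊g a⌋ ⌊g b⌋
    have hmaps : ∀ n ∈ Ico a b, ⌊g n⌋ ∈ J := by
      intro n hn
      rw [mem_Ico] at hn
      exact mem_Icc.2 ⟨Int.floor_le_floor (hmono a n le_rfl hn.1 hn.2.le),
        Int.floor_le_floor (hmono n b hn.1 hn.2.le le_rfl)⟩
    rw [← sum_fiberwise_of_maps_to hmaps]
    have hfib : ∀ j ∈ J, ‖∑ n ∈ Ico a b with ⌊g n⌋ = j, expTwoPiI (f n)‖ ≤ 6 / √lam := by
      intro j _
      refine (norm_sum_floor_fiber_le hlam hs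
        (fun x y hx hxy hy => (hgap x y hx hxy hy.le).1) j).trans ?_
      have e1 : √lam / lam = 1 / √lam := by
        rw [div_eq_div_iff hlam.ne' hs.ne']; linarith
      have e2 : 1 ≤ 1 / √lam := by
        rw [le_div_iff₀ hs, one_mul]; exact Real.sqrt_le_one.2 h1
      have e3 : 2 / √lam = 2 * (1 / √lam) := by ring
      have e4 : 6 / √lam = 6 * (1 / √lam) := by ring
      rw [e1, e3, e4]
      linarith
    have hcard : (J.card : ℝ) ≤ C * lam * ((b : ℝ) - a) + 2 := by
      have h2 := (hgap a b le_rfl hab le_rfl).2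
      have h3 : ⌊g a⌋ ≤ ⌊g b⌋ := Int.floor_le_floor (hmono a b le_rfl hab le_rfl)
      have h4 : (J.card : ℤ) = ⌊g b⌋ + 1 - ⌊g a⌋ := by
        simp only [J, Int.card_Icc]
        omega
      have h5 : (J.card : ℝ) = ⌊g b⌋ + 1 - ⌊g a⌋ := by exact_mod_cast h4
      have h6 := Int.floor_le (g b)
      have h7 := Int.lt_floor_add_one (g a)
      linarith
    calc _ ≤ ∑ j ∈ J, 6 / √lam := (norm_sum_le _ _).trans (sum_le_sum hfib)
      _ = J.card * (6 / √lam) := by rw [sum_const, nsmul_eq_mul]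
      _ ≤ (C * lam * ((b : ℝ) - a) + 2) * (6 / √lam) := by gcongr
      _ = _ := by
        field_simp
        rw [Real.sq_sqrt hlam.le]
        ring
  · have h2 : 1 ≤ √lam := Real.one_le_sqrt.2 h1.le
    calc ‖∑ n ∈ Ico a b, expTwoPiI (f n)‖ ≤ ∑ n ∈ Ico a b, ‖expTwoPiI (f n)‖ := norm_sum_le _ _
      _ = (b : ℝ) - a := by simp [norm_expTwoPiI, Nat.cast_sub hab]
      _ ≤ (6 * C) * ((b : ℝ) - a) * √lam := by
        have : (b : ℝ) - a ≤ (6 * C) * ((b : ℝ) - a) := le_mul_of_one_le_left hL (by linarith)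
        exact this.trans (le_mul_of_one_le_right (by positivity) h2)
      _ ≤ _ := by
        have : 0 ≤ 12 / √lam := by positivity
        linarith

lemma rpow_second_difference {γ x : ℝ} (h0 : 0 < γ) (h1 : γ < 1) (hx : 0 < x) :
    γ * (1 - γ) * (x + 2) ^ (γ - 2) ≤
        ((x + 1) ^ γ - x ^ γ) - ((x + 2) ^ γ - (x + 1) ^ γ) ∧
      ((x + 1) ^ γ - x ^ γ) - ((x + 2) ^ γ - (x + 1) ^ γ) ≤ γ * (1 - γ) * x ^ (γ - 2) := by
  have hd : ∀ (p t : ℝ), 0 < t → HasDerivAt (fun t : ℝ => t ^ p) (p * t ^ (p - 1)) t := fun p t ht =>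
    Real.hasDerivAt_rpow_const (Or.inl ht.ne')
  have hd1 : ∀ (p t : ℝ), 0 < t →
      HasDerivAt (fun t : ℝ => (t + 1) ^ p) (p * (t + 1) ^ (p - 1)) t := fun p t ht =>
    (hd p (t + 1) (by linarith)).comp_add_const t 1
  obtain ⟨ξ, hξ, e1⟩ := exists_hasDerivAt_eq_slope
    (fun t : ℝ => (t + 1) ^ γ - t ^ γ) (fun t => γ * (t + 1) ^ (γ - 1) - γ * t ^ (γ - 1))
    (show x < x + 1 by linarith)
    (fun t ht => ((hd1 γ t (by linarith [ht.1])).sub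
      (hd γ t (by linarith [ht.1]))).continuousAt.continuousWithinAt)
    (fun t ht => (hd1 γ t (by linarith [ht.1])).sub (hd γ t (by linarith [ht.1])))
  obtain ⟨η, hη, e2⟩ := exists_hasDerivAt_eq_slope
    (fun t : ℝ => t ^ (γ - 1)) (fun t => (γ - 1) * t ^ (γ - 1 - 1))
    (show ξ < ξ + 1 by linarith)
    (fun t ht => (hd (γ - 1) t (by linarith [ht.1, hξ.1])).continuousAt.continuousWithinAt)
    (fun t ht => hd (γ - 1) t (by linarith [ht.1, hξ.1]))
  simp only [add_sub_cancel_left, div_one] at e1 e2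
  have e3 : ((x + 1) ^ γ - x ^ γ) - ((x + 2) ^ γ - (x + 1) ^ γ) =
      γ * (1 - γ) * η ^ (γ - 2) := by
    rw [show γ - 1 - 1 = γ - 2 by ring] at e2
    rw [show x + 1 + 1 = x + 2 by ring] at e1
    linear_combination e1 + γ * e2
  have hη0 : 0 < η := by linarith [hη.1, hξ.1]
  have hc : 0 ≤ γ * (1 - γ) := mul_nonneg h0.le (by linarith)
  rw [e3]
  constructor
  · exact mul_le_mul_of_nonneg_left (Real.rpow_le_rpow_of_nonpos hη0
      (by linarith [hη.2, hξ.2]) (by linarith)) hc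
  · exact mul_le_mul_of_nonneg_left (Real.rpow_le_rpow_of_nonpos hx
      (by linarith [hη.1, hξ.1]) (by linarith)) hc

/-- Bound for the exponential sums with phase `αk - hk^γ` over an interval contained
in `[M, 8M - 2]`. -/
theorem norm_sum_expTwoPiI_rpow_le {γ M h α : ℝ} (h0 : 0 < γ) (h1 : γ < 1) (hM : 0 < M)
    (hh : 0 < h) {a b : ℕ} (hab : a ≤ b)
    (hmem : ∀ n : ℕ, a ≤ n → n < b → M ≤ n ∧ (n : ℝ) + 2 ≤ 8 * M) :
    ‖∑ n ∈ Ico a b, expTwoPiI (-(h * (n : ℝ) ^ γ)) * expTwoPiI (α * n)‖ ≤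
      384 * ((b : ℝ) - a) * √(h * (γ * (1 - γ) * (8 * M) ^ (γ - 2))) +
        12 / √(h * (γ * (1 - γ) * (8 * M) ^ (γ - 2))) := by
  simp_rw [← expTwoPiI_add]
  have hγ : 0 < γ * (1 - γ) := mul_pos h0 (by linarith)
  have := norm_sum_expTwoPiI_le_of_second_differences
    (f := fun n : ℕ => -(h * (n : ℝ) ^ γ) + α * n) (a := a) (b := b)
    (lam := h * (γ * (1 - γ) * (8 * M) ^ (γ - 2))) (C := 64) (by positivity) (by norm_num) hab ?_
  · norm_num at this ⊢
    exact this
  intro n ha hb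
  obtain ⟨m1, m2⟩ := hmem n ha hb
  have hn : (0 : ℝ) < n := by linarith
  obtain ⟨d1, d2⟩ := rpow_second_difference h0 h1 hn
  have e : ((-(h * ((n + 2 : ℕ) : ℝ) ^ γ) + α * (n + 2 : ℕ)) -
      (-(h * ((n + 1 : ℕ) : ℝ) ^ γ) + α * (n + 1 : ℕ))) -
      ((-(h * ((n + 1 : ℕ) : ℝ) ^ γ) + α * (n + 1 : ℕ)) - (-(h * (n : ℝ) ^ γ) + α * n)) =
      h * ((((n : ℝ) + 1) ^ γ - (n : ℝ) ^ γ) - (((n : ℝ) + 2) ^ γ - ((n : ℝ) + 1) ^ γ)) := by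
    push_cast
    ring
  rw [e]
  constructor
  · refine mul_le_mul_of_nonneg_left (le_trans ?_ d1) hh.le
    exact mul_le_mul_of_nonneg_left (Real.rpow_le_rpow_of_nonpos (by linarith) m2 (by linarith)) hγ.le
  · rw [mul_left_comm]
    refine mul_le_mul_of_nonneg_left (d2.trans ?_) hh.le
    rw [mul_left_comm]
    refine mul_le_mul_of_nonneg_left ?_ hγ.le
    refine (Real.rpow_le_rpow_of_nonpos hM m1 (by linarith)).trans ?_
    rw [Real.mul_rpow (by norm_num) hM.le, ← mul_assoc]
    refine le_mul_of_one_le_left (by positivity) ?_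
    have h8 : (8 : ℝ) ^ (-2 : ℝ) ≤ 8 ^ (γ - 2) :=
      Real.rpow_le_rpow_of_exponent_le (by norm_num) (by linarith)
    have h9 : (8 : ℝ) ^ (-2 : ℝ) = 1 / 64 := by
      rw [Real.rpow_neg (by norm_num)]; norm_num
    rw [h9] at h8
    linarith

lemma integral_expTwoPiI_intCast_mul (t : ℤ) :
    ∫ x in (0 : ℝ)..1, expTwoPiI (t * x) = if t = 0 then 1 else 0 := by
  split_ifs with ht
  · simp [ht, expTwoPiI_zero]
  · have hc : (2 * Real.pi * t * Complex.I : ℂ) ≠ 0 := by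
      simp [ht, Real.pi_ne_zero]
    have h1 : ∀ x : ℝ, expTwoPiI (t * x) = Complex.exp ((2 * Real.pi * t * Complex.I : ℂ) * x) := by
      intro x
      rw [expTwoPiI]
      congr 1
      push_cast
      ring
    simp_rw [h1]
    rw [integral_exp_mul_complex hc]
    have h2 := expTwoPiI_intCast t
    have h3 := h1 1
    rw [mul_one, h2] at h3
    rw [← h3]
    simp

lemma integral_norm_sq_sum_expTwoPiI (Q : Finset ℤ) :
    ∫ x in (0 : ℝ)..1, ‖∑ q ∈ Q, expTwoPiI (q * x)‖ ^ 2 = Q.card := by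
  have h : ∀ x : ℝ, ((‖∑ q ∈ Q, expTwoPiI (q * x)‖ ^ 2 : ℝ) : ℂ) =
      ∑ q ∈ Q, ∑ r ∈ Q, expTwoPiI ((q - r : ℤ) * x) := by
    intro x
    rw [Complex.ofReal_pow, ← Complex.mul_conj', map_sum, sum_mul_sum]
    refine sum_congr rfl fun q _ => sum_congr rfl fun r _ => ?_
    rw [conj_expTwoPiI, ← expTwoPiI_add]
    congr 1
    push_cast
    ring
  have hcont : ∀ t : ℤ, Continuous fun x : ℝ => expTwoPiI (t * x) := fun t =>
    continuous_expTwoPiI.comp (continuous_const.mul continuous_id)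
  have h2 : ((∫ x in (0 : ℝ)..1, ‖∑ q ∈ Q, expTwoPiI (q * x)‖ ^ 2 : ℝ) : ℂ) = Q.card := by
    rw [← intervalIntegral.integral_ofReal]
    simp_rw [h]
    rw [intervalIntegral.integral_finsetSum
      (fun q _ => (continuous_finsetSum _ fun r _ => hcont _).intervalIntegrable _ _)]
    have : ∀ q ∈ Q, ∫ x in (0 : ℝ)..1, ∑ r ∈ Q, expTwoPiI ((q - r : ℤ) * x) = 1 := by
      intro q hq
      rw [intervalIntegral.integral_finsetSum (fun r _ => (hcont _).intervalIntegrable _ _)]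
      simp_rw [integral_expTwoPiI_intCast_mul, sub_eq_zero]
      rw [sum_ite_eq, if_pos hq]
    rw [sum_congr rfl this]
    simp
  exact_mod_cast h2

/-- The bilinear form attached to a convolution kernel `φ` is bounded by the supremum of the
Fourier transform of `φ`. -/
theorem norm_sum_sum_toNat_sub_le {φ : ℕ → ℂ} {K : Finset ℕ} {B : ℝ}
    (hB : ∀ α : ℝ, ‖∑ k ∈ K, φ k * expTwoPiI (α * k)‖ ≤ B) {E Q : Finset ℤ}
    (hEQ : ∀ n ∈ E, ∀ q ∈ Q, ∃ k ∈ K, n = q + (k : ℤ)) :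
    ‖∑ n ∈ E, ∑ q ∈ Q, φ (n - q).toNat‖ ≤ B * √(E.card * Q.card) := by
  have hB0 : 0 ≤ B := (norm_nonneg _).trans (hB 0)
  rcases E.eq_empty_or_nonempty with rfl | hE
  · simp
  rcases Q.eq_empty_or_nonempty with rfl | hQ
  · simp
  have hE0 : (0 : ℝ) < E.card := by exact_mod_cast hE.card_pos
  have hQ0 : (0 : ℝ) < Q.card := by exact_mod_cast hQ.card_pos
  have hcont : ∀ t : ℤ, Continuous fun x : ℝ => expTwoPiI (t * x) := fun t =>
    continuous_expTwoPiI.comp (continuous_const.mul continuous_id)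
  have hcontK : ∀ k : ℕ, Continuous fun x : ℝ => expTwoPiI (x * k) := fun t =>
    continuous_expTwoPiI.comp (continuous_id.mul continuous_const)
  have hcontφ : ∀ (k : ℕ) (t : ℤ), Continuous fun x : ℝ => φ k * expTwoPiI (t * x) :=
    fun k t => continuous_const.mul (hcont t)
  set F : ℝ → ℂ := fun x => ∑ k ∈ K, φ k * expTwoPiI (x * k) with hF
  set SE : ℝ → ℂ := fun x => ∑ n ∈ E, expTwoPiI (n * x) with hSE
  set SQ : ℝ → ℂ := fun x => ∑ q ∈ Q, expTwoPiI (q * x) with hSQ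
  have cF : Continuous F := continuous_finsetSum _ fun k _ => continuous_const.mul (hcontK k)
  have cE : Continuous SE := continuous_finsetSum _ fun k _ => hcont k
  have cQ : Continuous SQ := continuous_finsetSum _ fun k _ => hcont k
  have hexpand : ∀ x, starRingEnd ℂ (SE x) * SQ x * F x =
      ∑ n ∈ E, ∑ q ∈ Q, ∑ k ∈ K, φ k * expTwoPiI ((q + k - n : ℤ) * x) := by
    intro x
    simp only [hF, hSE, hSQ]
    rw [map_sum, sum_mul_sum, sum_mul]
    refine sum_congr rfl fun n _ => ?_
    rw [sum_mul]
    refine sum_congr rfl fun q _ => ?_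
    rw [mul_sum]
    refine sum_congr rfl fun k _ => ?_
    rw [conj_expTwoPiI, mul_left_comm, ← expTwoPiI_add, ← expTwoPiI_add]
    congr 2
    push_cast
    ring
  have hintegral : ∑ n ∈ E, ∑ q ∈ Q, φ (n - q).toNat =
      ∫ x in (0 : ℝ)..1, starRingEnd ℂ (SE x) * SQ x * F x := by
    simp_rw [hexpand]
    rw [intervalIntegral.integral_finsetSum (fun n _ => (continuous_finsetSum _ fun q _ =>
      continuous_finsetSum _ fun k _ => hcontφ _ _).intervalIntegrable _ _)]
    refine sum_congr rfl fun n hn => ?_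
    rw [intervalIntegral.integral_finsetSum (fun q _ => (
      continuous_finsetSum _ fun k _ => hcontφ _ _).intervalIntegrable _ _)]
    refine sum_congr rfl fun q hq => ?_
    rw [intervalIntegral.integral_finsetSum (fun k _ =>
      (hcontφ k _).intervalIntegrable _ _)]
    simp_rw [intervalIntegral.integral_const_mul, integral_expTwoPiI_intCast_mul]
    obtain ⟨k, hk, hnk⟩ := hEQ n hn q hq
    rw [sum_eq_single_of_mem k hk]
    · rw [if_pos (by omega), mul_one]
      congr 1
      omega
    · intro l _ hlk
      rw [if_neg (by omega), mul_zero]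
  set t : ℝ := √(E.card / Q.card) with ht
  have ht0 : 0 < t := Real.sqrt_pos.2 (by positivity)
  have hpt : ∀ x, ‖starRingEnd ℂ (SE x) * SQ x * F x‖ ≤
      B / 2 * (t⁻¹ * ‖SE x‖ ^ 2 + t * ‖SQ x‖ ^ 2) := by
    intro x
    rw [norm_mul, norm_mul, RCLike.norm_conj]
    have h1 : ‖SE x‖ * ‖SQ x‖ ≤ (t⁻¹ * ‖SE x‖ ^ 2 + t * ‖SQ x‖ ^ 2) / 2 := by
      have h2 : 0 ≤ t⁻¹ * (‖SE x‖ - t * ‖SQ x‖) ^ 2 := by positivity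
      have h3 : t⁻¹ * (‖SE x‖ - t * ‖SQ x‖) ^ 2 =
          t⁻¹ * ‖SE x‖ ^ 2 + t * ‖SQ x‖ ^ 2 - 2 * (‖SE x‖ * ‖SQ x‖) := by
        field_simp
        ring
      linarith
    calc ‖SE x‖ * ‖SQ x‖ * ‖F x‖ ≤ (t⁻¹ * ‖SE x‖ ^ 2 + t * ‖SQ x‖ ^ 2) / 2 * B :=
          mul_le_mul h1 (hB x) (norm_nonneg _) (by positivity)
      _ = _ := by ring
  rw [hintegral]
  calc _ ≤ ∫ x in (0 : ℝ)..1, B / 2 * (t⁻¹ * ‖SE x‖ ^ 2 + t * ‖SQ x‖ ^ 2) := by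
        refine intervalIntegral.norm_integral_le_of_norm_le zero_le_one
          (Filter.Eventually.of_forall fun x _ => hpt x) ?_
        exact (Continuous.intervalIntegrable (by fun_prop) _ _)
    _ = B / 2 * (t⁻¹ * E.card + t * Q.card) := by
        rw [intervalIntegral.integral_const_mul, intervalIntegral.integral_add
          (Continuous.intervalIntegrable (by fun_prop) _ _)
          (Continuous.intervalIntegrable (by fun_prop) _ _), intervalIntegral.integral_const_mul,
          intervalIntegral.integral_const_mul, integral_norm_sq_sum_expTwoPiI,
          integral_norm_sq_sum_expTwoPiI]
    _ = B * √(E.card * Q.card) := by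
        have hE' : (E.card : ℝ) = √E.card * √E.card := (Real.mul_self_sqrt hE0.le).symm
        have hQ' : (Q.card : ℝ) = √Q.card * √Q.card := (Real.mul_self_sqrt hQ0.le).symm
        have sE := Real.sqrt_pos.2 hE0
        have sQ := Real.sqrt_pos.2 hQ0
        rw [ht, Real.sqrt_div hE0.le, Real.sqrt_mul hE0.le]
        have e1 : (√(E.card : ℝ) / √Q.card)⁻¹ * E.card = √E.card * √Q.card := by
          rw [inv_div, div_mul_eq_mul_div, div_eq_iff sE.ne']
          linear_combination √(Q.card : ℝ) * hE'
        have e2 : (√(E.card : ℝ) / √Q.card) * Q.card = √E.card * √Q.card := by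
          rw [div_mul_eq_mul_div, div_eq_iff sQ.ne']
          linear_combination √(E.card : ℝ) * hQ'
        rw [e1, e2]
        ring

/-- The Fourier expansion of the periodic triangle function `x ↦ max 0 (δ - ‖x‖)` off its
support, without the constant term. -/
theorem hasSum_triangle_fourier {δ x : ℝ} (hδ : 0 ≤ δ) (h1 : δ ≤ Int.fract x)
    (h2 : Int.fract x ≤ 1 - δ) :
    HasSum (fun n : ℕ => (1 - Real.cos (2 * Real.pi * n * δ)) / (n : ℝ) ^ 2 *
      Real.cos (2 * Real.pi * n * x)) (-(Real.pi ^ 2 * δ ^ 2)) := by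
  set y := Int.fract x with hy
  have key : ∀ z ∈ Set.Icc (0 : ℝ) 1, HasSum
      (fun n : ℕ => 1 / (n : ℝ) ^ 2 * Real.cos (2 * Real.pi * n * z))
      (Real.pi ^ 2 * (z ^ 2 - z + 1 / 6)) := by
    intro z hz
    convert! hasSum_one_div_nat_pow_mul_cos one_ne_zero hz using 1
    rw [show 2 * 1 = 2 by rfl, Polynomial.bernoulli]
    simp [sum_range_succ, bernoulli_one, bernoulli_two]
    norm_num [Nat.factorial, bernoulli, bernoulli'_one, bernoulli'_two]
    ring
  have hs := (key y ⟨by linarith, by linarith⟩).sub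
    (((key (y + δ) ⟨by linarith, by linarith⟩).add
      (key (y - δ) ⟨by linarith, by linarith⟩)).div_const 2)
  have e1 : Real.pi ^ 2 * (y ^ 2 - y + 1 / 6) - (Real.pi ^ 2 * ((y + δ) ^ 2 - (y + δ) + 1 / 6) +
      Real.pi ^ 2 * ((y - δ) ^ 2 - (y - δ) + 1 / 6)) / 2 = -(Real.pi ^ 2 * δ ^ 2) := by ring
  rw [e1] at hs
  convert! hs using 1
  ext n
  have e2 : Real.cos (2 * Real.pi * n * x) = Real.cos (2 * Real.pi * n * y) := by
    have : 2 * Real.pi * n * x = 2 * Real.pi * n * y + ((n * ⌊x⌋ : ℤ) : ℝ) * (2 * Real.pi) := by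
      have := Int.floor_add_fract x
      push_cast
      rw [hy]
      linear_combination (-2) * Real.pi * n * this
    rw [this, Real.cos_add_int_mul_two_pi]
  rw [e2, mul_add, mul_sub, Real.cos_add, Real.cos_sub]
  ring

lemma one_sub_cos_div_sq_le {n : ℕ} (hn : 1 ≤ n) {δ p : ℝ} (hδ : 0 < δ) (h0 : 0 ≤ p) (h2 : p ≤ 2) :
    (1 - Real.cos (2 * Real.pi * n * δ)) / (n : ℝ) ^ 2 ≤ 20 * δ ^ p * (n : ℝ) ^ (p - 2) := by
  have hn0 : (0 : ℝ) < n := by exact_mod_cast hn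
  have h1 : 1 - Real.cos (2 * Real.pi * n * δ) ≤ 20 * ((n : ℝ) * δ) ^ p := by
    rcases le_total ((n : ℝ) * δ) 1 with h | h
    · have h3 := Real.one_sub_sq_div_two_le_cos (x := 2 * Real.pi * n * δ)
      have h4 : ((n : ℝ) * δ) ^ (2 : ℝ) ≤ ((n : ℝ) * δ) ^ p :=
        Real.rpow_le_rpow_of_exponent_ge (by positivity) h h2
      rw [Real.rpow_two] at h4
      have h5 : Real.pi ^ 2 ≤ 10 := by
        have := Real.pi_lt_d2
        have := Real.pi_pos
        nlinarith
      have h6 : 0 ≤ ((n : ℝ) * δ) ^ 2 := by positivity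
      have h7 : (2 * Real.pi * n * δ) ^ 2 / 2 = 2 * Real.pi ^ 2 * ((n : ℝ) * δ) ^ 2 := by ring
      have h8 : Real.pi ^ 2 * ((n : ℝ) * δ) ^ 2 ≤ 10 * ((n : ℝ) * δ) ^ 2 :=
        mul_le_mul_of_nonneg_right h5 h6
      linarith
    · have := Real.one_le_rpow h h0
      have := Real.neg_one_le_cos (2 * Real.pi * n * δ)
      linarith
  rw [div_le_iff₀ (by positivity)]
  refine h1.trans (le_of_eq ?_)
  rw [Real.mul_rpow hn0.le hδ.le, Real.rpow_sub hn0, Real.rpow_two]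
  field_simp

/-- The bound for a frequency `n` in the Fourier expansion of the triangle function. -/
lemma triangle_coeff_mul_le {n : ℕ} {δ η κ L : ℝ} (hδ : 0 < δ) (hη0 : 0 < η)
    (hη : η ≤ 1 / 2) (hκ : 0 < κ) (hL : 0 ≤ L) :
    (1 - Real.cos (2 * Real.pi * n * δ)) / (n : ℝ) ^ 2 *
        (384 * L * √(n * κ) + 12 / √(n * κ)) ≤
      20 * (384 * L * √κ * δ ^ (1 / 2 - η) + 12 * δ ^ (3 / 2 - η) / √κ) *
        (n : ℝ) ^ (-1 - η) := by
  rcases Nat.eq_zero_or_pos n with rfl | hn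
  · simp only [Nat.cast_zero, mul_zero, zero_mul, Real.cos_zero, sub_self, zero_div]
    rw [Real.zero_rpow (by linarith), mul_zero]
  have hn0 : (0 : ℝ) < n := by exact_mod_cast hn
  have hs : 0 < √κ := Real.sqrt_pos.2 hκ
  have hsn : 0 < √(n : ℝ) := Real.sqrt_pos.2 hn0
  have h1 := one_sub_cos_div_sq_le hn hδ (p := 1 / 2 - η) (by linarith) (by linarith)
  have h2 := one_sub_cos_div_sq_le hn hδ (p := 3 / 2 - η) (by linarith) (by linarith)
  rw [Real.sqrt_mul hn0.le, mul_add]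
  have e1 : (n : ℝ) ^ (1 / 2 - η - 2) * √(n : ℝ) = (n : ℝ) ^ (-1 - η) := by
    rw [Real.sqrt_eq_rpow, ← Real.rpow_add hn0]; congr 1; ring
  have e2 : (n : ℝ) ^ (3 / 2 - η - 2) = (n : ℝ) ^ (-1 - η) * √(n : ℝ) := by
    rw [Real.sqrt_eq_rpow, ← Real.rpow_add hn0]; congr 1; ring
  calc _ ≤ 20 * δ ^ (1 / 2 - η) * (n : ℝ) ^ (1 / 2 - η - 2) * (384 * L * (√(n : ℝ) * √κ)) +
        20 * δ ^ (3 / 2 - η) * (n : ℝ) ^ (3 / 2 - η - 2) * (12 / (√(n : ℝ) * √κ)) := by gcongr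
    _ = _ := by
      rw [e2, ← e1]
      field_simp

/-- Let `E`, `Q` be finite sets of integers with `E - Q` in an interval contained in
`[M, 8M - 2]`, such that `k ^ γ + δ` keeps distance `δ` from the integers for `k ∈ E - Q`. Then
the product of the cardinalities of `E` and `Q` is small. -/
theorem sqrt_card_mul_card_le {γ M δ η : ℝ} (h0 : 0 < γ) (h1 : γ < 1) (hM : 0 < M) (hδ : 0 < δ)
    (hη0 : 0 < η) (hη : η ≤ 1 / 2) {a b : ℕ} (hab : a ≤ b)
    (hmem : ∀ n : ℕ, a ≤ n → n < b → M ≤ n ∧ (n : ℝ) + 2 ≤ 8 * M) {E Q : Finset ℤ}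
    (hEQ : ∀ n ∈ E, ∀ q ∈ Q, ∃ k ∈ Ico a b, n = q + (k : ℤ))
    (hfr : ∀ n ∈ E, ∀ q ∈ Q, δ ≤ Int.fract (((n - q).toNat : ℝ) ^ γ + δ) ∧
      Int.fract (((n - q).toNat : ℝ) ^ γ + δ) ≤ 1 - δ) :
    Real.pi ^ 2 * δ ^ 2 * √(E.card * Q.card) ≤
      20 * (384 * ((b : ℝ) - a) * √(γ * (1 - γ) * (8 * M) ^ (γ - 2)) * δ ^ (1 / 2 - η) +
        12 * δ ^ (3 / 2 - η) / √(γ * (1 - γ) * (8 * M) ^ (γ - 2))) *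
        ∑' n : ℕ, (n : ℝ) ^ (-1 - η) := by
  set κ := γ * (1 - γ) * (8 * M) ^ (γ - 2) with hκ
  have hκ0 : 0 < κ := by
    have : 0 < 1 - γ := by linarith
    positivity
  have hL : (0 : ℝ) ≤ (b : ℝ) - a := by
    have : (a : ℝ) ≤ b := by exact_mod_cast hab
    linarith
  set G := 20 * (384 * ((b : ℝ) - a) * √κ * δ ^ (1 / 2 - η) + 12 * δ ^ (3 / 2 - η) / √κ) with hG
  set R := √((E.card : ℝ) * Q.card) with hR
  set k : ℤ → ℤ → ℝ := fun n q => ((n - q).toNat : ℝ) ^ γ with hk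
  have hsum := hasSum_sum (s := E) fun n hn => hasSum_sum (s := Q) fun q hq =>
    hasSum_triangle_fourier hδ.le (hfr n hn q hq).1 (hfr n hn q hq).2
  have hz : HasSum (fun h : ℕ => G * (h : ℝ) ^ (-1 - η) * R)
      (G * (∑' n : ℕ, (n : ℝ) ^ (-1 - η)) * R) :=
    (((Real.summable_nat_rpow.2 (by linarith)).hasSum).mul_left G).mul_right R
  have hbound := hsum.norm_le_of_bounded hz ?_
  · rw [sum_const, sum_const, nsmul_eq_mul, nsmul_eq_mul, Real.norm_eq_abs] at hbound
    have e : (E.card : ℝ) * (Q.card * -(Real.pi ^ 2 * δ ^ 2)) =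
        -(Real.pi ^ 2 * δ ^ 2 * R * R) := by
      have : R * R = (E.card : ℝ) * Q.card := Real.mul_self_sqrt (by positivity)
      linear_combination Real.pi ^ 2 * δ ^ 2 * this
    rw [e, abs_neg, abs_of_nonneg (by positivity)] at hbound
    rcases (Real.sqrt_nonneg ((E.card : ℝ) * Q.card)).eq_or_lt with hR0 | hR0
    · rw [hR, ← hR0, mul_zero]
      have : 0 ≤ ∑' n : ℕ, (n : ℝ) ^ (-1 - η) := tsum_nonneg fun n => by positivity
      have : 0 ≤ G := by positivity
      positivity
    · exact le_of_mul_le_mul_right hbound hR0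
  · intro h
    set C := (1 - Real.cos (2 * Real.pi * h * δ)) / (h : ℝ) ^ 2 with hC
    have hC0 : 0 ≤ C := div_nonneg (by linarith [Real.cos_le_one (2 * Real.pi * h * δ)])
      (by positivity)
    rcases Nat.eq_zero_or_pos h with rfl | hh
    · simp only [hC, Nat.cast_zero, mul_zero, zero_mul, Real.cos_zero, sub_self, zero_div,
        sum_const_zero, norm_zero]
      rw [Real.zero_rpow (by linarith)]
      simp
    have hh0 : (0 : ℝ) < h := by exact_mod_cast hh
    have hB := norm_sum_sum_toNat_sub_le (E := E) (Q := Q)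
      (φ := fun k : ℕ => expTwoPiI (-(h * (k : ℝ) ^ γ)))
      (fun α => norm_sum_expTwoPiI_rpow_le (α := α) h0 h1 hM hh0 hab hmem) hEQ
    have hre : ∑ n ∈ E, ∑ q ∈ Q, C * Real.cos (2 * Real.pi * h * (k n q + δ)) =
        C * (expTwoPiI (-(h * δ)) * ∑ n ∈ E, ∑ q ∈ Q, expTwoPiI (-(h * k n q))).re := by
      rw [mul_sum, Complex.re_sum, mul_sum]
      refine sum_congr rfl fun n _ => ?_
      rw [mul_sum, Complex.re_sum, mul_sum]
      refine sum_congr rfl fun q _ => ?_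
      rw [← expTwoPiI_add, re_expTwoPiI, ← Real.cos_neg]
      congr 2
      ring
    rw [hre, norm_mul, Real.norm_of_nonneg hC0, Real.norm_eq_abs]
    calc _ ≤ C * ((384 * ((b : ℝ) - a) * √(h * κ) + 12 / √(h * κ)) * R) := by
          refine mul_le_mul_of_nonneg_left ((Complex.abs_re_le_norm _).trans ?_) hC0
          rw [norm_mul, norm_expTwoPiI, one_mul]
          exact hB
      _ = C * (384 * ((b : ℝ) - a) * √(h * κ) + 12 / √(h * κ)) * R := by ring
      _ ≤ _ := mul_le_mul_of_nonneg_right (triangle_coeff_mul_le hδ hη0 hη hκ0 hL)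
          (Real.sqrt_nonneg _)

lemma eventually_rpow_le_primeCounting {η : ℝ} (hη : 0 < η) :
    ∀ᶠ x : ℝ in Filter.atTop, x ^ (1 - η) ≤ (Nat.primeCounting ⌊x⌋₊ : ℝ) := by
  have l1 := (isLittleO_log_rpow_atTop hη).bound (show (0 : ℝ) < 1 / 4 by norm_num)
  have l2 := (isLittleO_log_rpow_atTop one_pos).bound (show (0 : ℝ) < 1 / 100 by norm_num)
  filter_upwards [l1, l2, Filter.eventually_ge_atTop 10] with x h1 h2 hx
  have hx0 : 0 < x := by linarith
  have hlog : 0 < Real.log x := Real.log_pos (by linarith)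
  rw [Real.norm_of_nonneg hlog.le, Real.norm_of_nonneg (by positivity)] at h1 h2
  rw [Real.rpow_one] at h2
  refine le_trans ?_ (Chebyshev.pi_ge' (by linarith))
  rw [le_div_iff₀ hlog]
  have h3 : x ^ (1 - η) * Real.log x ≤ x / 4 := by
    calc _ ≤ x ^ (1 - η) * (1 / 4 * x ^ η) := by gcongr
      _ = x / 4 := by
        rw [mul_left_comm, ← Real.rpow_add hx0, sub_add_cancel, Real.rpow_one]; ring
  have h4 : Real.log (x + 2) ≤ 2 * Real.log x := by
    rw [← Real.log_rpow hx0]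
    refine Real.log_le_log (by linarith) ?_
    rw [Real.rpow_two]
    nlinarith
  have h5 := Real.log_two_gt_d9
  nlinarith

lemma mul_rpow_sub_one_le_sub {γ x : ℝ} (h0 : 0 < γ) (h1 : γ < 1) (hx : 0 < x) :
    γ * (x + 1) ^ (γ - 1) ≤ (x + 1) ^ γ - x ^ γ := by
  have hd : ∀ t : ℝ, 0 < t → HasDerivAt (fun t : ℝ => t ^ γ) (γ * t ^ (γ - 1)) t := fun t ht =>
    Real.hasDerivAt_rpow_const (Or.inl ht.ne')
  obtain ⟨ξ, hξ, e1⟩ := exists_hasDerivAt_eq_slope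
    (fun t : ℝ => t ^ γ) (fun t => γ * t ^ (γ - 1)) (show x < x + 1 by linarith)
    (fun t ht => (hd t (by linarith [ht.1])).continuousAt.continuousWithinAt)
    (fun t ht => hd t (by linarith [ht.1]))
  simp only [add_sub_cancel_left, div_one] at e1
  rw [← e1]
  exact mul_le_mul_of_nonneg_left (Real.rpow_le_rpow_of_nonpos (by linarith [hξ.1]) hξ.2.le
    (by linarith)) h0.le

/-- If `k` is not of the form `⌊m ^ c⌋`, then `k ^ (1 / c) + δ` keeps distance `δ` from the
integers. -/
lemma fract_mem_of_ne_floor_rpow {c δ : ℝ} {k : ℕ} (hc : 1 < c) (hk : 0 < k) (hδ : 0 < δ)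
    (hle : 2 * δ ≤ ((k : ℝ) + 1) ^ (1 / c) - (k : ℝ) ^ (1 / c))
    (hne : ∀ m : ℕ, 0 < m → ⌊(m : ℝ) ^ c⌋ ≠ k) :
    δ ≤ Int.fract ((k : ℝ) ^ (1 / c) + δ) ∧ Int.fract ((k : ℝ) ^ (1 / c) + δ) ≤ 1 - δ := by
  have hk0 : (0 : ℝ) < k := by exact_mod_cast hk
  have hpos : 0 < (k : ℝ) ^ (1 / c) := by positivity
  have hc0 : 0 < c := by linarith
  have key : ∀ m : ℤ, (k : ℝ) ^ (1 / c) ≤ m → (m : ℝ) < ((k : ℝ) + 1) ^ (1 / c) → False := by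
    intro m h1 h2
    have hm : (0 : ℝ) < m := by linarith
    have hm' : 0 < m := by exact_mod_cast hm
    lift m to ℕ using hm'.le
    rw [Int.cast_natCast] at h1 h2 hm
    refine hne m (by exact_mod_cast hm') (Int.floor_eq_iff.2 ⟨?_, ?_⟩)
    · rw [one_div] at h1
      exact_mod_cast (Real.rpow_inv_le_iff_of_pos hk0.le hm.le hc0).1 h1
    · rw [one_div] at h2
      exact_mod_cast (Real.lt_rpow_inv_iff_of_pos hm.le (by linarith) hc0).1 h2
  set x := (k : ℝ) ^ (1 / c) + δ with hx
  have hf := Int.floor_add_fract x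
  have hf0 := Int.fract_lt_one x
  constructor
  · by_contra! h
    exact key ⌊x⌋ (by linarith) (by linarith [Int.floor_le x])
  · by_contra! h
    refine key (⌊x⌋ + 1) ?_ ?_ <;> push_cast <;> linarith

lemma floor_natCast_rpow_injective {c : ℝ} (hc : 1 < c) :
    Function.Injective fun p : ℕ => ⌊(p : ℝ) ^ c⌋ := by
  refine StrictMono.injective (strictMono_nat_of_lt_succ fun p => ?_)
  have := Real.add_rpow_le_rpow_add (a := p) (b := 1) (by positivity) zero_le_one hc.le
  rw [Real.one_rpow] at this
  have h2 := Int.floor_le_floor this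
  rw [Int.floor_add_one] at h2
  push_cast
  omega

lemma frequency_total_eq_mul_rpow {γ η d κ₀ X : ℝ} (hd : 0 < d) (hκ : 0 < κ₀) (hX : 0 < X) :
    384 * X * √(κ₀ * X ^ (γ - 2)) * (d * X ^ (γ - 1)) ^ (1 / 2 - η) +
        12 * (d * X ^ (γ - 1)) ^ (3 / 2 - η) / √(κ₀ * X ^ (γ - 2)) =
      (384 * √κ₀ * d ^ (1 / 2 - η) + 12 * d ^ (3 / 2 - η) / √κ₀) *
        X ^ (γ - 1 / 2 + η * (1 - γ)) := by
  have hs : √(X ^ (γ - 2)) = X ^ ((γ - 2) / 2) := by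
    rw [Real.sqrt_eq_rpow, ← Real.rpow_mul hX.le]
    congr 1
    ring
  have e1 : X ^ (γ - 1 / 2 + η * (1 - γ)) =
      X * X ^ ((γ - 2) / 2) * X ^ ((γ - 1) * (1 / 2 - η)) := by
    nth_rewrite 2 [← Real.rpow_one X]
    rw [← Real.rpow_add hX, ← Real.rpow_add hX]
    congr 1
    ring
  have e2 : X ^ (γ - 1 / 2 + η * (1 - γ)) =
      X ^ ((γ - 1) * (3 / 2 - η)) / X ^ ((γ - 2) / 2) := by
    rw [← Real.rpow_sub hX]
    congr 1
    ring
  rw [add_mul]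
  congr 1
  · rw [e1, Real.sqrt_mul hκ.le, hs, Real.mul_rpow hd.le (by positivity), ← Real.rpow_mul hX.le]
    ring
  · rw [e2, Real.sqrt_mul hκ.le, hs, Real.mul_rpow hd.le (by positivity), ← Real.rpow_mul hX.le]
    field_simp

lemma le_mul_rpow_of_sqrt_mul_le {γ η d C X x y : ℝ} (hd : 0 < d) (hX0 : 0 < X) (hx : 0 ≤ x)
    (hy : X ^ (γ * (1 - η)) / 8 ^ (γ * (1 - η)) ≤ y)
    (h : Real.pi ^ 2 * (d * X ^ (γ - 1)) ^ 2 * √(x * y) ≤ C * X ^ (γ - 1 / 2 + η * (1 - γ))) :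
    x ≤ C ^ 2 / (Real.pi ^ 4 * d ^ 4) * 8 ^ (γ * (1 - η)) *
      X ^ (3 - 3 * γ + 2 * η - γ * η) := by
  have hy0 : 0 ≤ y := le_trans (by positivity) hy
  have hsq := pow_le_pow_left₀ (by positivity) h 2
  rw [mul_pow _ (√(x * y)), Real.sq_sqrt (by positivity), mul_pow C] at hsq
  set u := X ^ (γ - 1) with hu
  set v := X ^ (γ - 1 / 2 + η * (1 - γ)) with hv
  set w := X ^ (γ * (1 - η)) with hw
  have hu0 : 0 < u := by positivity
  have hw0 : 0 < w := by positivity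
  have hXe : X ^ (3 - 3 * γ + 2 * η - γ * η) = v ^ 2 / (u ^ 4 * w) := by
    rw [hu, hv, hw, ← Real.rpow_natCast, ← Real.rpow_natCast, ← Real.rpow_mul hX0.le,
      ← Real.rpow_mul hX0.le, ← Real.rpow_add hX0, ← Real.rpow_sub hX0]
    congr 1
    push_cast
    ring
  have hle : Real.pi ^ 4 * d ^ 4 * u ^ 4 * (x * (w / 8 ^ (γ * (1 - η)))) ≤
      C ^ 2 * v ^ 2 := by
    calc _ ≤ Real.pi ^ 4 * d ^ 4 * u ^ 4 * (x * y) := by gcongr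
      _ = (Real.pi ^ 2 * (d * u) ^ 2) ^ 2 * (x * y) := by ring
      _ ≤ _ := hsq
  have h8 : (0 : ℝ) < 8 ^ (γ * (1 - η)) := by positivity
  rw [hXe]
  calc x = Real.pi ^ 4 * d ^ 4 * u ^ 4 * (x * (w / 8 ^ (γ * (1 - η)))) *
        (8 ^ (γ * (1 - η)) / (Real.pi ^ 4 * d ^ 4 * u ^ 4 * w)) := by
        have := Real.pi_pos
        field_simp
    _ ≤ C ^ 2 * v ^ 2 * (8 ^ (γ * (1 - η)) / (Real.pi ^ 4 * d ^ 4 * u ^ 4 * w)) := by gcongr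
    _ = _ := by
        have := Real.pi_pos
        field_simp

/-- For `1 < c < 3/2` and `ε > 0`, the number `Z_c(N)` of integers in the short interval
`(N, N(1 + (log N)⁻²)]` not representable as `⌊m^c⌋ + ⌊p^c⌋` with `m ≥ 1` and `p` prime
satisfies `Z_c(N) ≤ C N^{3 - 3/c + 5ε/6}` for sufficiently large `N`. -/
theorem short_interval_exceptional_bound (c ε : ℝ) (hc1 : 1 < c) (hc2 : c < 3 / 2)
    (hε : 0 < ε) :
    ∃ C : ℝ, ∀ᶠ N : ℝ in Filter.atTop,
      (({n : ℤ | N < (n : ℝ) ∧ (n : ℝ) ≤ N * (1 + ((Real.log N) ^ 2)⁻¹) ∧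
          ¬∃ m p : ℕ, 0 < m ∧ p.Prime ∧
            ⌊(m : ℝ) ^ c⌋ + ⌊(p : ℝ) ^ c⌋ = n}.ncard : ℝ) ≤
        C * N ^ (3 - 3 / c + 5 * ε / 6)) := by
  have hc0 : 0 < c := by linarith
  set γ : ℝ := 1 / c with hγ
  have h0 : 0 < γ := by positivity
  have h1 : γ < 1 := by rw [hγ, div_lt_one hc0]; exact hc1
  set η : ℝ := min (ε / 6) (1 / 4) with hη
  have hη0 : 0 < η := lt_min (by linarith) (by norm_num)
  have hη2 : η ≤ 1 / 2 := (min_le_right _ _).trans (by norm_num)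
  have hηε : η ≤ ε / 6 := min_le_left _ _
  set d : ℝ := γ / 2 with hd
  have hd0 : 0 < d := by positivity
  set κ₀ : ℝ := γ * (1 - γ) with hκ₀
  have hκ : 0 < κ₀ := mul_pos h0 (by linarith)
  set C₁ : ℝ := 20 * (384 * √κ₀ * d ^ (1 / 2 - η) + 12 * d ^ (3 / 2 - η) / √κ₀) *
    ∑' n : ℕ, (n : ℝ) ^ (-1 - η) with hC₁
  set e : ℝ := 3 - 3 * γ + 2 * η - γ * η with he
  set C₂ : ℝ := C₁ ^ 2 / (Real.pi ^ 4 * d ^ 4) * 8 ^ (γ * (1 - η)) with hC₂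
  refine ⟨C₂ * 4 ^ e, ?_⟩
  have hprimes : ∀ᶠ N : ℝ in Filter.atTop, ((N / 2) ^ γ) ^ (1 - η) ≤
      (Nat.primeCounting ⌊(N / 2) ^ γ⌋₊ : ℝ) :=
    ((tendsto_rpow_atTop h0).comp (Filter.tendsto_id.atTop_div_const two_pos)).eventually
      (eventually_rpow_le_primeCounting hη0)
  have hlog : ∀ᶠ N : ℝ in Filter.atTop, 1 ≤ Real.log N :=
    Real.tendsto_log_atTop.eventually_ge_atTop 1
  filter_upwards [hprimes, hlog, Filter.eventually_ge_atTop 4] with N hπ hlogN hN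
  have hN0 : 0 < N := by linarith
  have hN2 : N * (1 + ((Real.log N) ^ 2)⁻¹) ≤ 2 * N := by
    have : ((Real.log N) ^ 2)⁻¹ ≤ 1 := inv_le_one_of_one_le₀ (one_le_pow₀ hlogN)
    nlinarith
  set Z : Set ℤ := {n : ℤ | N < (n : ℝ) ∧ (n : ℝ) ≤ N * (1 + ((Real.log N) ^ 2)⁻¹) ∧
    ¬∃ m p : ℕ, 0 < m ∧ p.Prime ∧ ⌊(m : ℝ) ^ c⌋ + ⌊(p : ℝ) ^ c⌋ = n} with hZ
  have hfin : Z.Finite := by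
    refine (Set.finite_Icc ⌊N⌋ ⌊2 * N⌋).subset ?_
    rintro n ⟨hn1, hn2, -⟩
    exact ⟨by exact_mod_cast (Int.floor_le N).trans hn1.le, Int.le_floor.2 (hn2.trans hN2)⟩
  set E : Finset ℤ := hfin.toFinset with hE
  rw [Set.ncard_eq_toFinset_card Z hfin]
  set Q : Finset ℤ := (Nat.primesLE ⌊(N / 2) ^ γ⌋₊).image fun p : ℕ => ⌊(p : ℝ) ^ c⌋ with hQ
  have hQcard : ((N / 2) ^ γ) ^ (1 - η) ≤ (Q.card : ℝ) := by
    rw [hQ, card_image_of_injective _ (floor_natCast_rpow_injective hc1),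
      Nat.primesLE_card_eq_primeCounting]
    exact hπ
  set X : ℝ := 4 * N with hX
  have hX0 : 0 < X := by positivity
  set δ : ℝ := d * X ^ (γ - 1) with hδ
  have hδ0 : 0 < δ := by positivity
  set a : ℕ := ⌈N / 2⌉₊ with ha
  set b : ℕ := ⌊2 * N⌋₊ + 1 with hb
  have ha1 : N / 2 ≤ a := Nat.le_ceil _
  have hb1 : (b : ℝ) ≤ 2 * N + 1 := by
    rw [hb]
    push_cast
    linarith [Nat.floor_le (show 0 ≤ 2 * N by linarith)]
  have hab : a ≤ b := by
    refine Nat.ceil_le.2 ?_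
    rw [hb]
    push_cast
    linarith [Nat.lt_floor_add_one (2 * N)]
  have hmem : ∀ n : ℕ, a ≤ n → n < b → N / 2 ≤ n ∧ (n : ℝ) + 2 ≤ 8 * (N / 2) := by
    intro n hn1 hn2
    have hn1' : (a : ℝ) ≤ n := by exact_mod_cast hn1
    have hn2' : (n : ℝ) + 1 ≤ b := by exact_mod_cast hn2
    constructor <;> linarith
  have hQmem : ∀ q ∈ Q, ∃ p : ℕ, p.Prime ∧ ⌊(p : ℝ) ^ c⌋ = q ∧ 0 ≤ q ∧ (q : ℝ) ≤ N / 2 := by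
    intro q hq
    obtain ⟨p, hp, rfl⟩ := mem_image.1 hq
    rw [Nat.mem_primesLE] at hp
    refine ⟨p, hp.2, rfl, Int.floor_nonneg.2 (by positivity), (Int.floor_le _).trans ?_⟩
    have hp1 : (p : ℝ) ≤ (N / 2) ^ γ := (Nat.le_floor_iff (by positivity)).1 hp.1
    rw [hγ, one_div] at hp1
    exact (Real.le_rpow_inv_iff_of_pos (by positivity) (by positivity) hc0).1 hp1
  have hEQ : ∀ n ∈ E, ∀ q ∈ Q, ∃ k ∈ Ico a b, n = q + (k : ℤ) := by
    intro n hn q hq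
    obtain ⟨hn1, hn2, -⟩ := hfin.mem_toFinset.1 hn
    obtain ⟨p, -, -, hq0, hq1⟩ := hQmem q hq
    have hq0' : (0 : ℝ) ≤ q := by exact_mod_cast hq0
    have hnq : 0 ≤ n - q := by
      have : (q : ℝ) ≤ n := by linarith
      have : q ≤ n := by exact_mod_cast this
      omega
    obtain ⟨k, hk⟩ := Int.eq_ofNat_of_zero_le hnq
    have hk' : (k : ℝ) = n - q := by exact_mod_cast hk.symm
    refine ⟨k, mem_Ico.2 ⟨Nat.ceil_le.2 (by linarith), Nat.lt_succ_iff.2 (Nat.le_floor ?_)⟩,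
      by omega⟩
    linarith
  have hfr : ∀ n ∈ E, ∀ q ∈ Q, δ ≤ Int.fract (((n - q).toNat : ℝ) ^ γ + δ) ∧
      Int.fract (((n - q).toNat : ℝ) ^ γ + δ) ≤ 1 - δ := by
    intro n hn q hq
    obtain ⟨-, -, hn3⟩ := hfin.mem_toFinset.1 hn
    obtain ⟨p, hp, hpq, -⟩ := hQmem q hq
    obtain ⟨k, hk, rfl⟩ := hEQ n hn q hq
    rw [add_sub_cancel_left, Int.toNat_natCast]
    rw [mem_Ico] at hk
    obtain ⟨hk1, hk2⟩ := hmem k hk.1 hk.2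
    have hk0 : (0 : ℝ) < k := by linarith
    refine fract_mem_of_ne_floor_rpow hc1 (by exact_mod_cast hk0) hδ0 ?_ ?_
    · refine le_trans (le_of_eq ?_) ((mul_le_mul_of_nonneg_left (Real.rpow_le_rpow_of_nonpos
        (show (0 : ℝ) < k + 1 by positivity) (show (k : ℝ) + 1 ≤ X by linarith)
        (show γ - 1 ≤ 0 by linarith)) h0.le).trans (mul_rpow_sub_one_le_sub h0 h1 hk0))
      rw [hδ, hd]
      ring
    · intro m hm hmk
      exact hn3 ⟨m, p, hm, hp, by rw [hmk, hpq, add_comm]⟩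
  have hmain := sqrt_card_mul_card_le h0 h1 (show 0 < N / 2 by linarith) hδ0 hη0 hη2 hab hmem
    hEQ hfr
  rw [show 8 * (N / 2) = X by rw [hX]; ring] at hmain
  have hζ : 0 ≤ ∑' n : ℕ, (n : ℝ) ^ (-1 - η) := tsum_nonneg fun n => by positivity
  have hmain' : Real.pi ^ 2 * δ ^ 2 * √(E.card * Q.card) ≤
      C₁ * X ^ (γ - 1 / 2 + η * (1 - γ)) := by
    refine hmain.trans ?_
    have hL : (b : ℝ) - a ≤ X := by linarith
    calc _ ≤ 20 * (384 * X * √(κ₀ * X ^ (γ - 2)) * δ ^ (1 / 2 - η) +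
        12 * δ ^ (3 / 2 - η) / √(κ₀ * X ^ (γ - 2))) * ∑' n : ℕ, (n : ℝ) ^ (-1 - η) := by gcongr
      _ = _ := by
        rw [hδ, frequency_total_eq_mul_rpow hd0 hκ hX0, hC₁]
        ring
  have hsplit : ((N / 2) ^ γ) ^ (1 - η) = X ^ (γ * (1 - η)) / 8 ^ (γ * (1 - η)) := by
    rw [← Real.rpow_mul (by positivity), ← Real.div_rpow hX0.le (by norm_num), hX]
    congr 1
    ring
  rw [hsplit] at hQcard
  have hfinal : (E.card : ℝ) ≤ C₂ * X ^ e :=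
    le_mul_rpow_of_sqrt_mul_le hd0 hX0 (Nat.cast_nonneg _) hQcard hmain'
  have hC₂0 : 0 ≤ C₂ := by positivity
  refine hfinal.trans ?_
  rw [hX, Real.mul_rpow (by norm_num) hN0.le, ← mul_assoc]
  refine mul_le_mul_of_nonneg_left
    (Real.rpow_le_rpow_of_exponent_le (by linarith) ?_) (by positivity)
  have h3 : 3 / c = 3 * γ := by rw [hγ]; ring
  rw [h3, he]
  nlinarith [mul_pos h0 hη0]
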